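/- If G is an edge-colored graph on n vertices with n ≥ k ≥ 6 such that m(G) + c(G) = C(n,2) + t_{n,k−2} + 1 and G does not contain a rainbow K_k, then G is a complete graph. -/

import Mathlib

/-- `s` spans a rainbow clique in the edge-colored graph `(G, col)`:
`s` is a clique and distinct edges inside `s` receive distinct colors. -/
def IsRainbowClique {V : Type*} (G : SimpleGraph V) (col : Sym2 V → ℕ)
    (s : Finset V) : Prop :=
  G.IsClique s ∧
    ∀ a ∈ s, ∀ b ∈ s, ∀ c ∈ s, ∀ d ∈ s, a ≠ b → c ≠ d →
      s(a, b) ≠ s(c, d) → col s(a, b) ≠ col s(c, d)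

/-- `t_{n,r}`: the number of edges of the Turán graph `T_{n,r}`. -/
noncomputable def turanEdges (n r : ℕ) : ℕ :=
  (SimpleGraph.turanGraph n r).edgeSet.ncard

/-- The edge set of the copy of the Turán graph `T_{n,r}` on `Fin n` obtained by
relabelling the vertices of `SimpleGraph.turanGraph n r` along the
permutation `σ`. -/
def turanCopyEdges (n r : ℕ) (σ : Fin n ≃ Fin n) : Set (Sym2 (Fin n)) :=
  {e | e.map σ ∈ (SimpleGraph.turanGraph n r).edgeSet}

open Finset

theorem two_mul_choose_two_add (n : ℕ) : 2 * n.choose 2 + n = n * n := by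
  induction n with
  | zero => simp
  | succ n ih =>
    rw [Nat.choose_succ_succ' n 1, Nat.choose_one_right]
    linarith

theorem turanEdges_eq_card (n r : ℕ) :
    turanEdges n r = #(SimpleGraph.turanGraph n r).edgeFinset := by
  rw [turanEdges, Set.ncard_eq_toFinset_card', SimpleGraph.edgeFinset]

theorem two_mul_turanEdges_add (q r s : ℕ) (hr : 0 < r) (hs : s ≤ r) :
    2 * turanEdges (q * r + s) r + (q * r + s) * q + s * (q + 1) = (q * r + s) * (q * r + s) := by
  induction q with
  | zero =>
    have htop : SimpleGraph.turanGraph s r = ⊤ := SimpleGraph.turanGraph_eq_top.2 (Or.inr hs)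
    have hcard : turanEdges s r = s.choose 2 := by
      rw [turanEdges, htop, Set.ncard_eq_toFinset_card', ← SimpleGraph.edgeFinset,
        SimpleGraph.card_edgeFinset_top_eq_card_choose_two, Fintype.card_fin]
    simpa [hcard] using two_mul_choose_two_add s
  | succ q ih =>
    have hadd := SimpleGraph.card_edgeFinset_turanGraph_add (n := q * r + s) (r := r)
    rw [← turanEdges_eq_card, ← turanEdges_eq_card] at hadd
    have hn : (q + 1) * r + s = q * r + s + r := by ring
    have hc := two_mul_choose_two_add r
    obtain ⟨r, rfl⟩ : ∃ t, r = t + 1 := ⟨r - 1, by omega⟩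
    rw [Nat.add_sub_cancel] at hadd
    rw [hn, hadd]
    nlinarith

/-- The largest possible value of `m + c` for an edge-colored graph on `n` vertices without a
rainbow clique on `r + 2` vertices. -/
noncomputable def rainbowBound (n r : ℕ) : ℕ :=
  n.choose 2 + turanEdges n r + 1

theorem two_mul_rainbowBound_add (q r s : ℕ) (hr : 0 < r) (hs : s ≤ r) :
    2 * rainbowBound (q * r + s) r + (q * r + s) + (q * r + s) * q + s * (q + 1) =
      2 * ((q * r + s) * (q * r + s)) + 2 := by
  have h₁ := two_mul_turanEdges_add q r s hr hs
  have h₂ := two_mul_choose_two_add (q * r + s)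
  unfold rainbowBound
  linarith

theorem rainbowBound_succ (n r : ℕ) (hr : 0 < r) :
    rainbowBound (n + 1) r + n / r = rainbowBound n r + 2 * n := by
  have hlt := Nat.mod_lt n hr
  have h₁ := two_mul_rainbowBound_add (n / r) r (n % r) hr hlt.le
  have h₂ := two_mul_rainbowBound_add (n / r) r (n % r + 1) hr hlt
  have hn : n / r * r + n % r = n := Nat.div_add_mod' n r
  have hn' : n / r * r + (n % r + 1) = n + 1 := by rw [← add_assoc, hn]
  rw [hn] at h₁
  rw [hn'] at h₂
  linarith

theorem two_mul_rainbowBound_lt (n r : ℕ) (hr : 0 < r) (hn : 2 * r ≤ n) :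
    2 * rainbowBound (n + 1) r < (n + 1) * (2 * n + 1 - n / r) := by
  have hlt := Nat.mod_lt n hr
  have h := two_mul_rainbowBound_add (n / r) r (n % r + 1) hr hlt
  have hn' : n / r * r + (n % r + 1) = n + 1 := by rw [← add_assoc, Nat.div_add_mod']
  rw [hn'] at h
  have hq : 2 ≤ n / r := (Nat.le_div_iff_mul_le hr).2 hn
  have hle : n / r ≤ n := Nat.div_le_self n r
  obtain ⟨t, ht⟩ : ∃ t, 2 * n + 1 = t + n / r := ⟨2 * n + 1 - n / r, by omega⟩
  rw [ht, Nat.add_sub_cancel]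
  nlinarith [Nat.zero_le (n % r * (n / r + 1))]

theorem rainbowBound_add_of_le (n r : ℕ) (hr : 0 < r) (hrn : r ≤ n) (hn : n ≤ 2 * r) :
    rainbowBound n r + 2 * n = n * n + r + 1 := by
  obtain ⟨s, rfl⟩ := Nat.exists_eq_add_of_le hrn
  have h := two_mul_rainbowBound_add 1 r s hr (by omega)
  simp only [one_mul] at h
  linarith

section Weight

variable {V : Type*} (G : SimpleGraph V) (col : Sym2 V → ℕ)

open Classical in
/-- The edges of `G` with both endpoints in `W`. -/
noncomputable def edgesIn (W : Finset V) : Finset (Sym2 V) :=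
  W.sym2.filter (· ∈ G.edgeSet)

/-- The number of edges plus the number of colors of the subgraph induced on `W`. -/
noncomputable def weight (W : Finset V) : ℕ :=
  #(edgesIn G W) + #((edgesIn G W).image col)

variable {G} in
theorem mem_edgesIn {W : Finset V} {e : Sym2 V} :
    e ∈ edgesIn G W ↔ (∀ v ∈ e, v ∈ W) ∧ e ∈ G.edgeSet := by
  simp [edgesIn, mem_sym2_iff]

variable {G} in
theorem mk_mem_edgesIn {W : Finset V} {u w : V} :
    s(u, w) ∈ edgesIn G W ↔ (u ∈ W ∧ w ∈ W) ∧ G.Adj u w := by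
  simp [mem_edgesIn]

variable [DecidableEq V]

/-- The edges of the subgraph induced on `W` that contain `v`. -/
noncomputable def starIn (W : Finset V) (v : V) : Finset (Sym2 V) :=
  (edgesIn G W).filter (v ∈ ·)

open Classical in
/-- The colors of the subgraph induced on `W` that only appear on edges containing `v`. -/
noncomputable def satColors (W : Finset V) (v : V) : Finset ℕ :=
  ((edgesIn G W).image col).filter (fun a => ∀ e ∈ edgesIn G W, col e = a → v ∈ e)

variable {G col}

theorem edgesIn_erase (W : Finset V) (v : V) :
    edgesIn G (W.erase v) = (edgesIn G W).filter (v ∉ ·) := by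
  ext e
  simp only [mem_edgesIn, mem_filter, mem_erase]
  constructor
  · rintro ⟨h, he⟩
    exact ⟨⟨fun w hw => (h w hw).2, he⟩, fun hv => (h v hv).1 rfl⟩
  · rintro ⟨⟨h, he⟩, hv⟩
    exact ⟨fun w hw => ⟨fun hwv => hv (hwv ▸ hw), h w hw⟩, he⟩

theorem mem_satColors {W : Finset V} {v : V} {a : ℕ} :
    a ∈ satColors G col W v ↔
      (∃ e ∈ edgesIn G W, col e = a) ∧ ∀ e ∈ edgesIn G W, col e = a → v ∈ e := by
  simp [satColors]

theorem weight_erase_add (W : Finset V) (v : V) :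
    weight G col (W.erase v) + #(starIn G W v) + #(satColors G col W v) = weight G col W := by
  have hedges : #(edgesIn G (W.erase v)) + #(starIn G W v) = #(edgesIn G W) := by
    rw [edgesIn_erase, starIn, add_comm]
    exact card_filter_add_card_filter_not _
  have hcolors : #((edgesIn G (W.erase v)).image col) + #(satColors G col W v) =
      #((edgesIn G W).image col) := by
    rw [← card_union_of_disjoint]
    · congr 1
      ext a
      simp only [mem_union, mem_image, mem_satColors, edgesIn_erase, mem_filter]
      grind
    · rw [disjoint_left]
      intro a ha hs
      obtain ⟨e, he, rfl⟩ := mem_image.1 ha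
      rw [edgesIn_erase, mem_filter] at he
      exact he.2 ((mem_satColors.1 hs).2 e he.1 rfl)
  unfold weight
  omega

theorem exists_eq_mk_of_mem_starIn {W : Finset V} {v : V} {e : Sym2 V} (he : e ∈ starIn G W v) :
    ∃ u ∈ W, G.Adj v u ∧ e = s(v, u) := by
  obtain ⟨he, hv⟩ := mem_filter.1 he
  obtain ⟨u, rfl⟩ := Sym2.mem_iff_exists.1 hv
  rw [mk_mem_edgesIn] at he
  exact ⟨u, he.1.2, he.2, rfl⟩

theorem card_starIn_le (W : Finset V) {v : V} (hv : v ∈ W) : #(starIn G W v) + 1 ≤ #W := by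
  have hsub : starIn G W v ⊆ (W.erase v).image (fun u => s(v, u)) := by
    intro e he
    obtain ⟨u, hu, hadj, rfl⟩ := exists_eq_mk_of_mem_starIn he
    exact mem_image_of_mem _ (mem_erase.2 ⟨hadj.ne', hu⟩)
  have h := (card_le_card hsub).trans card_image_le
  have := card_erase_add_one hv
  omega

theorem card_starIn_le_of_not_adj {W : Finset V} {v u : V} (hv : v ∈ W) (hu : u ∈ W)
    (huv : u ≠ v) (hadj : ¬ G.Adj v u) : #(starIn G W v) + 2 ≤ #W := by
  have hsub : starIn G W v ⊆ ((W.erase v).erase u).image (fun u => s(v, u)) := by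
    intro e he
    obtain ⟨w, hw, hadj', rfl⟩ := exists_eq_mk_of_mem_starIn he
    refine mem_image_of_mem _ (mem_erase.2 ⟨?_, mem_erase.2 ⟨hadj'.ne', hw⟩⟩)
    rintro rfl
    exact hadj hadj'
  have h := (card_le_card hsub).trans card_image_le
  have h₁ := card_erase_add_one hv
  have h₂ := card_erase_add_one (mem_erase.2 ⟨huv, hu⟩)
  omega

theorem satColors_subset_image_starIn (W : Finset V) (v : V) :
    satColors G col W v ⊆ (starIn G W v).image col := by
  intro a ha
  obtain ⟨⟨e, he, rfl⟩, h⟩ := mem_satColors.1 ha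
  exact mem_image_of_mem _ (mem_filter.2 ⟨he, h e he rfl⟩)

theorem card_satColors_le (W : Finset V) (v : V) : #(satColors G col W v) ≤ #(starIn G W v) :=
  (card_le_card (satColors_subset_image_starIn W v)).trans card_image_le

theorem filter_mem_eq_toFinset {W : Finset V} {e : Sym2 V} (he : e ∈ edgesIn G W) :
    W.filter (· ∈ e) = e.toFinset := by
  ext v
  simpa using fun hv => (mem_edgesIn.1 he).1 v hv

theorem card_filter_mem_eq_two {W : Finset V} {e : Sym2 V} (he : e ∈ edgesIn G W) :
    #(W.filter (· ∈ e)) = 2 := by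
  rw [filter_mem_eq_toFinset he]
  exact Sym2.card_toFinset_of_not_isDiag e (G.not_isDiag_of_mem_edgeSet (mem_edgesIn.1 he).2)

theorem sum_card_filter_mem (W : Finset V) {F : Finset (Sym2 V)} (hF : F ⊆ edgesIn G W) :
    ∑ v ∈ W, #(F.filter (v ∈ ·)) = 2 * #F := by
  have h := sum_card_bipartiteAbove_eq_sum_card_bipartiteBelow
    (fun (v : V) (e : Sym2 V) => v ∈ e) (s := W) (t := F)
  simp only [bipartiteAbove, bipartiteBelow] at h
  rw [h, sum_congr rfl (fun e he => card_filter_mem_eq_two (hF he))]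
  simp [mul_comm]

open Classical in
/-- The vertices of `W` contained in every edge of color `a`. -/
noncomputable def satVertices (G : SimpleGraph V) (col : Sym2 V → ℕ) (W : Finset V) (a : ℕ) :
    Finset V :=
  W.filter (fun v => ∀ e ∈ edgesIn G W, col e = a → v ∈ e)

theorem sum_card_satColors (W : Finset V) :
    ∑ v ∈ W, #(satColors G col W v) =
      ∑ a ∈ (edgesIn G W).image col, #(satVertices G col W a) := by
  classical
  have h := sum_card_bipartiteAbove_eq_sum_card_bipartiteBelow
    (fun (v : V) (a : ℕ) => ∀ e ∈ edgesIn G W, col e = a → v ∈ e) (s := W)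
    (t := (edgesIn G W).image col)
  simpa only [bipartiteAbove, bipartiteBelow, satColors, satVertices] using h

theorem satVertices_subset {W : Finset V} {e : Sym2 V} (he : e ∈ edgesIn G W) :
    satVertices G col W (col e) ⊆ W.filter (· ∈ e) := by
  intro v hv
  obtain ⟨hvW, hv⟩ := mem_filter.1 hv
  exact mem_filter.2 ⟨hvW, hv e he rfl⟩

theorem card_satVertices_le_two {W : Finset V} {a : ℕ} (ha : a ∈ (edgesIn G W).image col) :
    #(satVertices G col W a) ≤ 2 := by
  obtain ⟨e, he, rfl⟩ := mem_image.1 ha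
  exact (card_le_card (satVertices_subset he)).trans (card_filter_mem_eq_two he).le

theorem eq_of_two_le_card_satVertices {W : Finset V} {e f : Sym2 V} (he : e ∈ edgesIn G W)
    (hf : f ∈ edgesIn G W) (hef : col e = col f) (h : 2 ≤ #(satVertices G col W (col e))) :
    e = f := by
  have h₁ := eq_of_subset_of_card_le (satVertices_subset (col := col) he)
    ((card_filter_mem_eq_two he).le.trans h)
  have h₂ := eq_of_subset_of_card_le (satVertices_subset (col := col) hf)
    ((card_filter_mem_eq_two hf).le.trans (hef ▸ h))
  rw [hef, h₂, filter_mem_eq_toFinset he, filter_mem_eq_toFinset hf] at h₁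
  ext v
  rw [← Sym2.mem_toFinset, ← Sym2.mem_toFinset, h₁]

/-- Averaging: some vertex has small degree plus saturated degree. -/
theorem exists_weight_lt_weight_erase_add (W : Finset V) (t : ℕ)
    (h : 2 * weight G col W < #W * t) :
    ∃ v ∈ W, weight G col W < weight G col (W.erase v) + t := by
  by_contra! hcon
  have h₁ : ∑ v ∈ W, #(starIn G W v) = 2 * #(edgesIn G W) :=
    sum_card_filter_mem W Subset.rfl
  have h₂ : ∑ v ∈ W, #(satColors G col W v) ≤ 2 * #((edgesIn G W).image col) := by
    rw [sum_card_satColors, mul_comm]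
    exact sum_le_card_nsmul _ _ 2 fun a ha => card_satVertices_le_two ha
  have h₃ : #W * t ≤ ∑ v ∈ W, (#(starIn G W v) + #(satColors G col W v)) := by
    refine card_nsmul_le_sum _ _ t fun v hv => ?_
    have := hcon v hv
    have := weight_erase_add (G := G) (col := col) W v
    omega
  rw [sum_add_distrib] at h₃
  unfold weight at h
  omega

theorem two_mul_card_edgesIn_le (W : Finset V) : 2 * #(edgesIn G W) ≤ #W * (#W - 1) := by
  rw [← sum_card_filter_mem W Subset.rfl]
  exact sum_le_card_nsmul _ _ _ fun v hv => Nat.le_sub_of_add_le (card_starIn_le W hv)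

theorem weight_le (W : Finset V) : weight G col W ≤ #W * (#W - 1) := by
  have h₁ := two_mul_card_edgesIn_le (G := G) W
  have h₂ : #((edgesIn G W).image col) ≤ #(edgesIn G W) := card_image_le
  unfold weight
  omega

theorem isRainbowClique_of_le_weight {W : Finset V} (h : #W * (#W - 1) ≤ weight G col W) :
    IsRainbowClique G col W := by
  have h₁ := two_mul_card_edgesIn_le (G := G) W
  have h₂ : #((edgesIn G W).image col) ≤ #(edgesIn G W) := card_image_le
  have hinj : Set.InjOn col (edgesIn G W) := card_image_iff.1 (by unfold weight at h; omega)
  have hclique : G.IsClique W := by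
    intro v hv u hu hvu
    by_contra hadj
    have hlt : ∑ v ∈ W, #((edgesIn G W).filter (v ∈ ·)) < ∑ _v ∈ W, (#W - 1) := by
      refine sum_lt_sum (fun w hw => Nat.le_sub_of_add_le (card_starIn_le W hw)) ⟨v, hv, ?_⟩
      have := card_starIn_le_of_not_adj hv hu hvu.symm hadj
      unfold starIn at this
      omega
    rw [sum_card_filter_mem W Subset.rfl, sum_const, smul_eq_mul] at hlt
    unfold weight at h
    omega
  refine ⟨hclique, fun a ha b hb c hc d hd hab hcd hne heq => hne (hinj ?_ ?_ heq)⟩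
  · exact mk_mem_edgesIn.2 ⟨⟨ha, hb⟩, hclique ha hb hab⟩
  · exact mk_mem_edgesIn.2 ⟨⟨hc, hd⟩, hclique hc hd hcd⟩

omit [DecidableEq V] in
theorem IsRainbowClique.subset {s t : Finset V} (ht : IsRainbowClique G col t) (hst : s ⊆ t) :
    IsRainbowClique G col s :=
  ⟨ht.1.subset (coe_subset.2 hst), fun a ha b hb c hc d hd =>
    ht.2 a (hst ha) b (hst hb) c (hst hc) d (hst hd)⟩

/-- If few edges are missing or repeat a color, deleting vertices greedily leaves a rainbow
clique. -/
theorem exists_isRainbowClique_of_le_weight_add (k : ℕ) (W : Finset V)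
    (h : #W * (#W - 1) + k ≤ weight G col W + #W) :
    ∃ s ⊆ W, #s = k ∧ IsRainbowClique G col s := by
  induction hn : #W generalizing W with
  | zero =>
    have := weight_le (G := G) (col := col) W
    rw [hn] at h this
    refine ⟨∅, empty_subset _, by simp; omega, by simp [IsRainbowClique]⟩
  | succ n ih =>
    by_cases hw : #W * (#W - 1) ≤ weight G col W
    · have := weight_le (G := G) (col := col) W
      obtain ⟨s, hs, hk⟩ := exists_subset_card_eq (s := W) (n := k) (by omega)
      exact ⟨s, hs, hk, (isRainbowClique_of_le_weight hw).subset hs⟩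
    · rw [hn, Nat.add_sub_cancel] at h hw
      obtain ⟨v, hv, hlt⟩ := exists_weight_lt_weight_erase_add (G := G) (col := col) W (2 * n)
        (by rw [hn]; linarith)
      have hcard : #(W.erase v) = n := by rw [card_erase_of_mem hv, hn, Nat.add_sub_cancel]
      obtain ⟨s, hs, hk⟩ := ih (W.erase v) (by
        rw [hcard]
        rcases n with _ | n
        · omega
        · rw [Nat.add_sub_cancel]
          nlinarith) hcard
      exact ⟨s, hs.trans (erase_subset _ _), hk⟩

theorem IsRainbowClique.insert {L : Finset V} {v : V} (hL : IsRainbowClique G col L) (hv : v ∉ L)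
    (hadj : ∀ u ∈ L, G.Adj v u)
    (hinj : ∀ u ∈ L, ∀ w ∈ L, col s(v, u) = col s(v, w) → u = w)
    (hnew : ∀ u ∈ L, ∀ a ∈ L, ∀ b ∈ L, a ≠ b → col s(v, u) ≠ col s(a, b)) :
    IsRainbowClique G col (insert v L) := by
  refine ⟨?_, ?_⟩
  · rw [coe_insert]
    exact hL.1.insert fun u hu _ => hadj u hu
  · intro a ha b hb c hc d hd hab hcd hne heq
    have swap : ∀ x y : V, s(x, y) = s(y, x) := fun x y => Sym2.eq_swap
    rw [mem_insert] at ha hb hc hd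
    have hL2 := hL.2
    rcases ha with rfl | ha <;> rcases hb with rfl | hb <;> rcases hc with rfl | hc <;>
      rcases hd with rfl | hd <;> grind

/-- A clique on `W` whose vertices are split into `r` parts of almost equal sizes so that the color
of an edge between two parts is used on no other edge. -/
structure IsTuranColored (G : SimpleGraph V) (col : Sym2 V → ℕ) (W : Finset V) {r : ℕ}
    (p : V → Fin r) : Prop where
  adj : ∀ u ∈ W, ∀ w ∈ W, u ≠ w → G.Adj u w
  cross : ∀ u ∈ W, ∀ w ∈ W, ∀ a ∈ W, ∀ b ∈ W, p u ≠ p w → a ≠ b →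
    col s(u, w) = col s(a, b) → s(u, w) = s(a, b)
  equitable : ∀ i j, #(W.filter (p · = i)) ≤ #(W.filter (p · = j)) + 1

namespace IsTuranColored

variable {W : Finset V} {r : ℕ} {p : V → Fin r}

omit [DecidableEq V] in
theorem div_le_card (h : IsTuranColored G col W p) (i : Fin r) :
    #W / r ≤ #(W.filter (p · = i)) := by
  by_contra! hlt
  have hsum : #W = ∑ j, #(W.filter (p · = j)) :=
    card_eq_sum_card_fiberwise (fun _ _ => mem_coe.2 (mem_univ _))
  have hstrict : ∑ j, #(W.filter (p · = j)) < ∑ _j : Fin r, #W / r :=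
    sum_lt_sum (fun j _ => (h.equitable j i).trans hlt) ⟨i, mem_univ _, hlt⟩
  rw [← hsum, sum_const, card_univ, Fintype.card_fin, smul_eq_mul] at hstrict
  exact absurd hstrict (not_lt.2 (Nat.mul_div_le _ _))

omit [DecidableEq V] in
theorem exists_ne (h : IsTuranColored G col W p) (hW : 2 * r ≤ #W) (i : Fin r) (b : V) :
    ∃ u ∈ W, p u = i ∧ u ≠ b := by
  have hr : 0 < r := i.pos
  have h2 : 1 < #(W.filter (p · = i)) :=
    lt_of_lt_of_le ((Nat.le_div_iff_mul_le hr).2 hW) (h.div_le_card i)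
  obtain ⟨u, hu, hub⟩ := exists_mem_ne h2 b
  exact ⟨u, (mem_filter.1 hu).1, (mem_filter.1 hu).2, hub⟩

/-- A transversal of the parts together with one more vertex is rainbow. -/
theorem isRainbowClique_insert_image (h : IsTuranColored G col W p) {s : Fin r → V}
    (hs : ∀ i, s i ∈ W) (hps : ∀ i, p (s i) = i) {w : V} (hw : w ∈ W) :
    IsRainbowClique G col (insert w (univ.image s)) := by
  have hmem : ∀ x ∈ insert w (univ.image s), x ∈ W ∧ (x = w ∨ x = s (p x)) := by
    intro x hx
    rcases mem_insert.1 hx with rfl | hx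
    · exact ⟨hw, Or.inl rfl⟩
    · obtain ⟨i, -, rfl⟩ := mem_image.1 hx
      exact ⟨hs i, Or.inr (by rw [hps])⟩
  have hsym : ∀ x y : V, s(x, y) = s(y, x) := fun x y => Sym2.eq_swap
  refine ⟨fun x hx y hy => h.adj x (hmem x hx).1 y (hmem y hy).1, ?_⟩
  intro a ha b hb c hc d hd hab hcd hne heq
  obtain ⟨haW, ha⟩ := hmem a ha
  obtain ⟨hbW, hb⟩ := hmem b hb
  obtain ⟨hcW, hc⟩ := hmem c hc
  obtain ⟨hdW, hd⟩ := hmem d hd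
  by_cases hpab : p a = p b
  · by_cases hpcd : p c = p d
    · grind
    · exact hne (h.cross c hcW d hdW a haW b hbW hpcd hab heq.symm).symm
  · exact hne (h.cross a haW b hbW c hcW d hdW hpab hcd heq)

theorem card_insert_image {s : Fin r → V} (hps : ∀ i, p (s i) = i) {w : V} (hw : w ≠ s (p w)) :
    #(insert w (univ.image s)) = r + 1 := by
  rw [card_insert_of_notMem, card_image_of_injective, card_univ, Fintype.card_fin]
  · intro i j hij
    rw [← hps i, ← hps j, hij]
  · intro hmem
    obtain ⟨i, -, rfl⟩ := mem_image.1 hmem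
    exact hw (by rw [hps])

/-- Without a rainbow clique on `r + 2` vertices, edges inside different parts share their color. -/
theorem color_eq_of_ne (h : IsTuranColored G col W p) (hW : 2 * r ≤ #W)
    (hno : ¬ ∃ t ⊆ W, #t = r + 2 ∧ IsRainbowClique G col t) {w w' z z' : V}
    (hw : w ∈ W) (hw' : w' ∈ W) (hz : z ∈ W) (hz' : z' ∈ W) (hww : w ≠ w') (hzz : z ≠ z')
    (hpw : p w = p w') (hpz : p z = p z') (hpwz : p w ≠ p z) :
    col s(w, w') = col s(z, z') := by
  by_contra hne
  choose s₀ hs₀ hps₀ _ using fun i => h.exists_ne hW i w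
  set s : Fin r → V := fun i => if i = p w then w else if i = p z then z else s₀ i with hs_def
  have hs : ∀ i, s i ∈ W := by
    intro i
    simp only [hs_def]
    split_ifs <;> simp [*]
  have hps : ∀ i, p (s i) = i := by
    intro i
    simp only [hs_def]
    split_ifs <;> simp [*]
  have hsw : s (p w) = w := by simp [hs_def]
  have hsz : s (p z) = z := by simp [hs_def, hpwz.symm]
  set L := insert w' (univ.image s) with hL
  have hmem : ∀ x ∈ L, x ∈ W ∧ (x = w' ∨ x = s (p x)) := by
    intro x hx
    rcases mem_insert.1 hx with rfl | hx
    · exact ⟨hw', Or.inl rfl⟩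
    · obtain ⟨i, -, rfl⟩ := mem_image.1 hx
      exact ⟨hs i, Or.inr (by rw [hps])⟩
  have hz'L : z' ∉ L := by
    intro hx
    rcases (hmem z' hx).2 with rfl | hx
    · exact hpwz (hpw.trans hpz.symm)
    · rw [← hpz, hsz] at hx
      exact hzz hx.symm
  have hLsub : L ⊆ W := fun x hx => (hmem x hx).1
  have hcross : ∀ u ∈ L, u ≠ z → p z' ≠ p u := by
    intro u hu huz hp
    rcases (hmem u hu).2 with rfl | hx
    · exact hpwz (hpw.trans (hpz.trans hp).symm)
    · rw [← hp, ← hpz, hsz] at hx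
      exact huz hx
  have hzne : ∀ u ∈ L, z' ≠ u := fun u hu hzu => hz'L (hzu ▸ hu)
  refine hno ⟨insert z' L, insert_subset hz' hLsub, ?_, ?_⟩
  · rw [card_insert_of_notMem hz'L, hL, card_insert_image hps]
    rw [← hpw, hsw]
    exact hww.symm
  · refine (h.isRainbowClique_insert_image hs hps hw').insert hz'L
      (fun u hu => h.adj z' hz' u (hLsub hu) (hzne u hu)) ?_ ?_
    · intro u hu x hx heq
      by_cases huz : u = z
      · by_cases hxz : x = z
        · rw [huz, hxz]
        · exact (Sym2.congr_right.1 (h.cross z' hz' x (hLsub hx) z' hz' u (hLsub hu)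
            (hcross x hx hxz) (hzne u hu) heq.symm)).symm
      · exact Sym2.congr_right.1 (h.cross z' hz' u (hLsub hu) z' hz' x (hLsub hx)
          (hcross u hu huz) (hzne x hx) heq)
    · intro u hu a ha b hb hab heq
      have hnot : s(z', u) ≠ s(a, b) := by
        intro he
        have hz'ab : z' ∈ s(a, b) := he ▸ Sym2.mem_mk_left z' u
        rcases Sym2.mem_iff.1 hz'ab with rfl | rfl
        · exact hz'L ha
        · exact hz'L hb
      by_cases huz : u = z
      · by_cases hpab : p a = p b
        · have hsym : ∀ x y : V, s(x, y) = s(y, x) := fun x y => Sym2.eq_swap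
          have h₁ := (hmem a ha).2
          have h₂ := (hmem b hb).2
          grind
        · exact hnot (h.cross a (hLsub ha) b (hLsub hb) z' hz' u (hLsub hu) hpab (hzne u hu)
            heq.symm).symm
      · exact hnot (h.cross z' hz' u (hLsub hu) a (hLsub ha) b (hLsub hb) (hcross u hu huz)
          hab heq)

theorem color_eq (h : IsTuranColored G col W p) (hW : 2 * r ≤ #W) (hr : 2 ≤ r)
    (hno : ¬ ∃ t ⊆ W, #t = r + 2 ∧ IsRainbowClique G col t) {w w' z z' : V}
    (hw : w ∈ W) (hw' : w' ∈ W) (hz : z ∈ W) (hz' : z' ∈ W) (hww : w ≠ w') (hzz : z ≠ z')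
    (hpw : p w = p w') (hpz : p z = p z') :
    col s(w, w') = col s(z, z') := by
  by_cases hpwz : p w = p z
  · obtain ⟨i, hi⟩ := Fintype.exists_ne_of_one_lt_card (by rw [Fintype.card_fin]; omega) (p w)
    obtain ⟨x, hx, hpx, -⟩ := h.exists_ne hW i w
    obtain ⟨y, hy, hpy, hyx⟩ := h.exists_ne hW i x
    rw [h.color_eq_of_ne hW hno hw hw' hx hy hww hyx.symm hpw (hpx.trans hpy.symm)
      (by rw [hpx]; exact hi.symm)]
    exact h.color_eq_of_ne hW hno hx hy hz hz' hyx.symm hzz (hpx.trans hpy.symm) hpz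
      (by rw [hpx, ← hpwz]; exact hi)
  · exact h.color_eq_of_ne hW hno hw hw' hz hz' hww hzz hpw hpz hpwz

end IsTuranColored

theorem exists_saturating_neighbors (W : Finset V) (v : V) :
    ∃ S ⊆ W.erase v, (∀ u ∈ S, G.Adj v u) ∧ Set.InjOn (fun u => col s(v, u)) S ∧
      (∀ u ∈ S, ∀ e ∈ edgesIn G W, col e = col s(v, u) → v ∈ e) ∧
      #S = #(satColors G col W v) := by
  have hex : ∀ a ∈ satColors G col W v, ∃ u ∈ W.erase v, G.Adj v u ∧ col s(v, u) = a := by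
    intro a ha
    obtain ⟨e, he, rfl⟩ := mem_image.1 (satColors_subset_image_starIn W v ha)
    obtain ⟨u, hu, hadj, rfl⟩ := exists_eq_mk_of_mem_starIn he
    exact ⟨u, mem_erase.2 ⟨hadj.ne', hu⟩, hadj, rfl⟩
  have : Nonempty V := ⟨v⟩
  choose! f hfW hfadj hfcol using hex
  refine ⟨(satColors G col W v).image f, ?_, ?_, ?_, ?_, ?_⟩
  · exact image_subset_iff.2 hfW
  · simpa using hfadj
  · intro x hx y hy hxy
    obtain ⟨a, ha, rfl⟩ := mem_image.1 (mem_coe.1 hx)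
    obtain ⟨b, hb, rfl⟩ := mem_image.1 (mem_coe.1 hy)
    simp only [hfcol a ha, hfcol b hb] at hxy
    rw [hxy]
  · intro u hu e he heq
    obtain ⟨a, ha, rfl⟩ := mem_image.1 hu
    rw [hfcol a ha] at heq
    exact (mem_satColors.1 ha).2 e he heq
  · refine card_image_of_injOn fun a ha b hb hab => ?_
    rw [← hfcol a ha, ← hfcol b hb, hab]

theorem exists_card_image_eq (C : Finset ℕ) {j : ℕ} (hj : 0 < j) (hjC : j ≤ #C) :
    ∃ g : ℕ → ℕ, #(C.image g) = j := by
  obtain ⟨T, hTC, hT⟩ := exists_subset_card_eq hjC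
  obtain ⟨b, hb⟩ : T.Nonempty := card_pos.1 (hT ▸ hj)
  refine ⟨fun y => if y ∈ T then y else b, ?_⟩
  rw [← hT]
  congr 1
  ext y
  simp only [mem_image]
  constructor
  · rintro ⟨x, -, rfl⟩
    split_ifs with h
    · exact h
    · exact hb
  · exact fun hy => ⟨y, hTC hy, if_pos hy⟩

/-- Merging colors reduces the upper bound on the weight to the case of equality. -/
theorem weight_le_rainbowBound {W : Finset V} {r : ℕ} (hr : 2 ≤ r) (hW : 2 * r ≤ #W)
    (hexact : ∀ col' : Sym2 V → ℕ, weight G col' W = rainbowBound #W r →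
      (¬ ∃ t ⊆ W, #t = r + 2 ∧ IsRainbowClique G col' t) →
      ∃ p : V → Fin r, IsTuranColored G col' W p)
    (hno : ¬ ∃ t ⊆ W, #t = r + 2 ∧ IsRainbowClique G col t) :
    weight G col W ≤ rainbowBound #W r := by
  by_contra! hlt
  have hm : #(edgesIn G W) < rainbowBound #W r := by
    have h₁ := two_mul_card_edgesIn_le (G := G) W
    have h₂ := two_mul_choose_two_add #W
    rw [Nat.mul_sub_one] at h₁
    unfold rainbowBound
    omega
  obtain ⟨g, hg⟩ := exists_card_image_eq ((edgesIn G W).image col)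
    (j := rainbowBound #W r - #(edgesIn G W)) (by omega) (by unfold weight at hlt; omega)
  rw [image_image] at hg
  obtain ⟨p, hp⟩ := hexact (g ∘ col) (by unfold weight; omega) (by
    rintro ⟨t, htW, ht, hclique, hrainbow⟩
    exact hno ⟨t, htW, ht, hclique, fun a ha b hb c hc d hd hab hcd hne heq =>
      hrainbow a ha b hb c hc d hd hab hcd hne (congrArg g heq)⟩)
  have hp' : IsTuranColored G col W p :=
    ⟨hp.adj, fun u hu w hw a ha b hb hpuw hab heq =>
      hp.cross u hu w hw a ha b hb hpuw hab (congrArg g heq), hp.equitable⟩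
  have hinj : Set.InjOn g ((edgesIn G W).image col) := by
    intro x hx y hy hxy
    obtain ⟨e, he, rfl⟩ := mem_image.1 (mem_coe.1 hx)
    obtain ⟨f, hf, rfl⟩ := mem_image.1 (mem_coe.1 hy)
    induction e using Sym2.ind with | _ u w =>
    induction f using Sym2.ind with | _ a b =>
    obtain ⟨⟨hu, hw⟩, huw⟩ := mk_mem_edgesIn.1 he
    obtain ⟨⟨ha, hb⟩, hab⟩ := mk_mem_edgesIn.1 hf
    by_cases hpuw : p u = p w
    · by_cases hpab : p a = p b
      · exact hp'.color_eq hW hr hno hu hw ha hb huw.ne hab.ne hpuw hpab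
      · rw [hp.cross a ha b hb u hu w hw hpab huw.ne hxy.symm]
    · rw [hp.cross u hu w hw a ha b hb hpuw hab.ne hxy]
  have hcard := card_image_of_injOn hinj
  rw [image_image, hg] at hcard
  unfold weight at hlt
  omega

/-- The induction step: a Turán coloring extends over a vertex of small degree. -/
theorem exists_isTuranColored_of_erase {W : Finset V} {n r : ℕ} (hr : 3 ≤ r) (hn : 2 * r ≤ n)
    (hWn : #W = n + 1)
    (ih : ∀ v ∈ W, ∀ col' : Sym2 V → ℕ, weight G col' (W.erase v) = rainbowBound n r →
      (¬ ∃ t ⊆ W.erase v, #t = r + 2 ∧ IsRainbowClique G col' t) →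
      ∃ p : V → Fin r, IsTuranColored G col' (W.erase v) p)
    (hw : weight G col W = rainbowBound (n + 1) r)
    (hno : ¬ ∃ t ⊆ W, #t = r + 2 ∧ IsRainbowClique G col t) :
    ∃ p : V → Fin r, IsTuranColored G col W p := by
  obtain ⟨v, hv, hlt⟩ := exists_weight_lt_weight_erase_add (G := G) (col := col) W
    (2 * n + 1 - n / r) (by rw [hw, hWn]; exact two_mul_rainbowBound_lt n r (by omega) hn)
  have hcard : #(W.erase v) = n := by rw [card_erase_of_mem hv, hWn, Nat.add_sub_cancel]
  have hno' : ¬ ∃ t ⊆ W.erase v, #t = r + 2 ∧ IsRainbowClique G col t :=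
    fun ⟨t, ht, h⟩ => hno ⟨t, ht.trans (erase_subset _ _), h⟩
  have hle : weight G col (W.erase v) ≤ rainbowBound n r := by
    have := weight_le_rainbowBound (G := G) (col := col) (W := W.erase v) (r := r) (by omega)
      (by omega) (by rw [hcard]; exact ih v hv) hno'
    rwa [hcard] at this
  have hsucc := rainbowBound_succ n r (by omega)
  have hq : 2 ≤ n / r := (Nat.le_div_iff_mul_le (by omega)).2 hn
  have hqr : n / r * r ≤ n := Nat.div_mul_le_self n r
  have hqn : n / r ≤ n := Nat.div_le_self n r
  have hdeg := weight_erase_add (G := G) (col := col) W v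
  have hstar := card_starIn_le (G := G) W hv
  obtain ⟨p, hp⟩ := ih v hv col (by omega) hno'
  obtain ⟨S, hSW, hSadj, hSinj, hSsat, hScard⟩ := exists_saturating_neighbors (G := G) (col := col) W v
  have hvW : v ∉ W.erase v := notMem_erase v W
  have hWsub : W.erase v ⊆ W := erase_subset v W
  have hSnew : ∀ u ∈ S, ∀ a ∈ W.erase v, ∀ b ∈ W.erase v, a ≠ b →
      col s(v, u) ≠ col s(a, b) := by
    intro u hu a ha b hb hab heq
    have hmem := hSsat u hu s(a, b)
      (mk_mem_edgesIn.2 ⟨⟨hWsub ha, hWsub hb⟩, hp.adj a ha b hb hab⟩) heq.symm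
    rcases Sym2.mem_iff.1 hmem with rfl | rfl
    · exact hvW ha
    · exact hvW hb
  obtain ⟨j, hj⟩ : ∃ j, ∀ u ∈ S, p u ≠ j := by
    by_contra! hall
    choose s hsS hps using hall
    have hsub : univ.image s ⊆ S := by
      intro x hx
      obtain ⟨i, -, rfl⟩ := mem_image.1 hx
      exact hsS i
    have hbig : #(univ.image s) < #S := by
      have h₁ : #(univ.image s) ≤ r := card_image_le.trans (by simp)
      obtain ⟨r', rfl⟩ : ∃ t, r = t + 1 := ⟨r - 1, by omega⟩
      have h₂ : 2 * r' ≤ n / (r' + 1) * r' := Nat.mul_le_mul_right _ hq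
      rw [Nat.mul_succ] at hqr
      omega
    obtain ⟨w, hwS, hwim⟩ := exists_mem_notMem_of_card_lt_card hbig
    have hLS : insert w (univ.image s) ⊆ S := insert_subset hwS hsub
    have hvL : v ∉ insert w (univ.image s) := fun h => hvW (hSW (hLS h))
    refine hno ⟨insert v (insert w (univ.image s)), ?_, ?_, ?_⟩
    · exact insert_subset hv ((hLS.trans hSW).trans hWsub)
    · rw [card_insert_of_notMem hvL, IsTuranColored.card_insert_image hps]
      exact fun h => hwim (h ▸ mem_image_of_mem s (mem_univ _))
    · exact (hp.isRainbowClique_insert_image (fun i => hSW (hsS i)) hps (hSW hwS)).insert hvL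
        (fun u hu => hSadj u (hLS hu)) (fun u hu w hw h => hSinj (hLS hu) (hLS hw) h)
        (fun u hu a ha b hb => hSnew u (hLS hu) a (hSW (hLS ha)) b (hSW (hLS hb)))
  have hpart : (W.erase v).filter (p · = j) ⊆ W.erase v \ S := by
    intro x hx
    obtain ⟨hxW, hx⟩ := mem_filter.1 hx
    exact mem_sdiff.2 ⟨hxW, fun hxS => hj x hxS hx⟩
  have hdiv := hp.div_le_card j
  have hpartcard := card_le_card hpart
  rw [card_sdiff_of_subset hSW] at hpartcard
  have hSle := card_le_card hSW
  rw [hcard] at hdiv hpartcard hSle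
  have hpart_eq : (W.erase v).filter (p · = j) = W.erase v \ S :=
    eq_of_subset_of_card_le hpart (by rw [card_sdiff_of_subset hSW, hcard]; omega)
  have hS : ∀ u ∈ W.erase v, p u ≠ j → u ∈ S := by
    intro u hu hpu
    by_contra huS
    have hmem : u ∈ (W.erase v).filter (p · = j) := hpart_eq ▸ mem_sdiff.2 ⟨hu, huS⟩
    exact hpu (mem_filter.1 hmem).2
  have hvadj : ∀ u ∈ W.erase v, G.Adj v u := by
    intro u hu
    by_contra hadj
    have := card_starIn_le_of_not_adj hv (hWsub hu) (ne_of_mem_erase hu) hadj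
    omega
  have hpartcolor : ∀ u ∈ W.erase v, p u = j → ∀ x y, x ∈ W.erase v → p x ≠ j →
      (y = v ∨ y ∈ W.erase v ∧ p x ≠ p y) → col s(v, u) ≠ col s(x, y) := by
    intro u hu hpu x y hx hpx hy heq
    have hxS := hS x hx hpx
    have hsym : ∀ x y : V, s(x, y) = s(y, x) := fun x y => Sym2.eq_swap
    obtain ⟨hA, hB, hC⟩ : (∀ t ∈ S, col s(v, t) = col s(v, u) → t = x) ∧
        (∀ c ∈ W.erase v, ∀ d ∈ W.erase v, p c ≠ p d → col s(c, d) = col s(v, u) →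
          x = c ∨ x = d) ∧
        (∀ c ∈ W.erase v, ∀ d ∈ W.erase v, c ≠ d → p c = p d → col s(c, d) ≠ col s(v, u)) := by
      rcases hy with rfl | ⟨hy, hpxy⟩
      · rw [hsym x y] at heq
        refine ⟨fun t ht h => hSinj ht hxS (h.trans heq), fun c hc d hd hpcd h => ?_,
          fun c hc d hd hcd _ h => ?_⟩
        · exact absurd (h.trans heq).symm
            (hSnew x hxS c hc d hd (fun h => hpcd (congrArg p h)))
        · exact hSnew x hxS c hc d hd hcd (h.trans heq).symm
      · have hxy : x ≠ y := fun h => hpxy (congrArg p h)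
        refine ⟨fun t ht h => ?_, fun c hc d hd hpcd h => ?_, fun c hc d hd hcd hpcd h => ?_⟩
        · exact absurd (h.trans heq) (hSnew t ht x hx y hy hxy)
        · have := hp.cross c hc d hd x hx y hy hpcd hxy (h.trans heq)
          exact Sym2.mem_iff.1 (this ▸ Sym2.mem_mk_left x y)
        · have := hp.cross x hx y hy c hc d hd hpxy hcd (h.trans heq).symm
          rcases Sym2.eq_iff.1 this with ⟨rfl, rfl⟩ | ⟨rfl, rfl⟩
          · exact hpxy hpcd
          · exact hpxy hpcd.symm
    obtain ⟨i, hi⟩ : ∃ i, i ∉ ({j, p x} : Finset (Fin r)) := by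
      by_contra! hall
      have h₁ := card_le_card (fun i _ => hall i : univ ⊆ ({j, p x} : Finset (Fin r)))
      have h₂ : #({j, p x} : Finset (Fin r)) ≤ 2 := card_le_two
      rw [card_univ, Fintype.card_fin] at h₁
      omega
    simp only [mem_insert, mem_singleton, not_or] at hi
    obtain ⟨hij, hipx⟩ := hi
    have hWr : 2 * r ≤ #(W.erase v) := by omega
    choose s₀ hs₀ hps₀ hs₀x using fun i => hp.exists_ne hWr i x
    set s : Fin r → V := fun i => if i = j then u else s₀ i with hs_def
    have hs : ∀ i, s i ∈ W.erase v := by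
      intro i
      simp only [hs_def]
      split_ifs
      · exact hu
      · exact hs₀ i
    have hps : ∀ i, p (s i) = i := by
      intro i
      simp only [hs_def]
      split_ifs with h
      · rw [hpu, h]
      · exact hps₀ i
    have hsx : ∀ i, s i ≠ x := by
      intro i
      simp only [hs_def]
      split_ifs with h
      · rintro rfl
        exact hpx hpu
      · exact hs₀x i
    have hsj : s j = u := by simp [hs_def]
    obtain ⟨w, hwW, hpw, hws⟩ := hp.exists_ne hWr i (s i)
    set L := insert w (univ.image s) with hL
    have hmem : ∀ y ∈ L, y ∈ W.erase v ∧ y ≠ x ∧ (y = u ∨ y ∈ S) := by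
      intro y hy
      rcases mem_insert.1 hy with rfl | hy
      · refine ⟨hwW, fun h => hipx (by rw [← hpw, h]), Or.inr (hS y hwW (by rwa [hpw]))⟩
      · obtain ⟨i', -, rfl⟩ := mem_image.1 hy
        refine ⟨hs i', hsx i', ?_⟩
        by_cases hij' : i' = j
        · exact Or.inl (by rw [hij', hsj])
        · exact Or.inr (hS _ (hs i') (by rwa [hps]))
    have hLsub : L ⊆ W.erase v := fun y hy => (hmem y hy).1
    have hvL : v ∉ L := fun h => hvW (hLsub h)
    refine hno ⟨insert v L, insert_subset hv (hLsub.trans hWsub), ?_, ?_⟩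
    · rw [card_insert_of_notMem hvL, hL, IsTuranColored.card_insert_image hps]
      rwa [hpw]
    · refine (hp.isRainbowClique_insert_image hs hps hwW).insert hvL
        (fun y hy => hvadj y (hLsub hy)) ?_ ?_
      · intro y hy z hz hyz
        obtain ⟨-, hyx, rfl | hyS⟩ := hmem y hy
        · obtain ⟨-, hzx, rfl | hzS⟩ := hmem z hz
          · rfl
          · exact absurd (hA z hzS hyz.symm) hzx
        · obtain ⟨-, hzx, rfl | hzS⟩ := hmem z hz
          · exact absurd (hA y hyS hyz) hyx
          · exact hSinj hyS hzS hyz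
      · intro y hy a ha b hb hab heq'
        obtain ⟨-, hyx, rfl | hyS⟩ := hmem y hy
        · by_cases hpab : p a = p b
          · exact hC a (hLsub ha) b (hLsub hb) hab hpab heq'.symm
          · rcases hB a (hLsub ha) b (hLsub hb) hpab heq'.symm with h | h
            · exact (hmem a ha).2.1 h.symm
            · exact (hmem b hb).2.1 h.symm
        · exact hSnew y hyS a (hLsub ha) b (hLsub hb) hab heq'
  refine ⟨Function.update p v j, ?_, ?_, ?_⟩
  · intro u hu w hw huw
    by_cases huv : u = v
    · subst huv
      exact hvadj w (mem_erase.2 ⟨huw.symm, hw⟩)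
    · by_cases hwv : w = v
      · subst hwv
        exact (hvadj u (mem_erase.2 ⟨huw, hu⟩)).symm
      · exact hp.adj u (mem_erase.2 ⟨huv, hu⟩) w (mem_erase.2 ⟨hwv, hw⟩) huw
  · have hsym : ∀ x y : V, s(x, y) = s(y, x) := fun x y => Sym2.eq_swap
    have hcross : ∀ u ∈ W, ∀ w ∈ W, Function.update p v j u ≠ Function.update p v j w →
        (u ∈ W.erase v ∧ w ∈ W.erase v ∧ p u ≠ p w) ∨
          ∃ t ∈ W.erase v, p t ≠ j ∧ s(u, w) = s(v, t) := by
      intro u hu w hw huw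
      by_cases huv : u = v
      · subst huv
        have hwu : w ≠ u := fun h => huw (by rw [h])
        rw [Function.update_self, Function.update_of_ne hwu] at huw
        exact Or.inr ⟨w, mem_erase.2 ⟨hwu, hw⟩, huw.symm, rfl⟩
      · by_cases hwv : w = v
        · subst hwv
          rw [Function.update_self, Function.update_of_ne huv] at huw
          exact Or.inr ⟨u, mem_erase.2 ⟨huv, hu⟩, huw, hsym _ _⟩
        · rw [Function.update_of_ne huv, Function.update_of_ne hwv] at huw
          exact Or.inl ⟨mem_erase.2 ⟨huv, hu⟩, mem_erase.2 ⟨hwv, hw⟩, huw⟩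
    have hedge : ∀ a ∈ W, ∀ b ∈ W, a ≠ b → (a ∈ W.erase v ∧ b ∈ W.erase v) ∨
        ∃ t ∈ W.erase v, s(a, b) = s(v, t) := by
      intro a ha b hb hab
      by_cases hav : a = v
      · subst hav
        exact Or.inr ⟨b, mem_erase.2 ⟨hab.symm, hb⟩, rfl⟩
      · by_cases hbv : b = v
        · subst hbv
          exact Or.inr ⟨a, mem_erase.2 ⟨hab, ha⟩, hsym _ _⟩
        · exact Or.inl ⟨mem_erase.2 ⟨hav, ha⟩, mem_erase.2 ⟨hbv, hb⟩⟩
    intro u hu w hw a ha b hb hpuw hab heq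
    rcases hcross u hu w hw hpuw with ⟨hu', hw', hpuw'⟩ | ⟨t, ht, hpt, huw⟩
    · rcases hedge a ha b hb hab with ⟨ha', hb'⟩ | ⟨t', ht', hab'⟩
      · exact hp.cross u hu' w hw' a ha' b hb' hpuw' hab heq
      · rw [hab'] at heq
        by_cases hpt' : p t' = j
        · by_cases hpu : p u = j
          · rw [hsym u w] at heq
            exact absurd heq.symm (hpartcolor t' ht' hpt' w u hw' (fun h => hpuw' (hpu.trans h.symm))
              (Or.inr ⟨hu', hpuw'.symm⟩))
          · exact absurd heq.symm (hpartcolor t' ht' hpt' u w hu' hpu (Or.inr ⟨hw', hpuw'⟩))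
        · exact absurd heq.symm (hSnew t' (hS t' ht' hpt') u hu' w hw'
            (fun h => hpuw' (congrArg p h)))
    · rw [huw] at heq ⊢
      rcases hedge a ha b hb hab with ⟨ha', hb'⟩ | ⟨t', ht', hab'⟩
      · exact absurd heq (hSnew t (hS t ht hpt) a ha' b hb' hab)
      · rw [hab'] at heq ⊢
        by_cases hpt' : p t' = j
        · rw [hsym v t] at heq
          exact absurd heq.symm (hpartcolor t' ht' hpt' t v ht hpt (Or.inl rfl))
        · rw [hSinj (hS t ht hpt) (hS t' ht' hpt') heq]
  · have hcards : ∀ i, #(W.filter (Function.update p v j · = i)) =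
        #((W.erase v).filter (p · = i)) + if i = j then 1 else 0 := by
      intro i
      have hagree : (W.erase v).filter (Function.update p v j · = i) =
          (W.erase v).filter (p · = i) :=
        filter_congr fun x hx => by rw [Function.update_of_ne (ne_of_mem_erase hx)]
      conv_lhs => rw [← insert_erase hv]
      rw [filter_insert, hagree, Function.update_self]
      split_ifs with h₁ h₂ h₂
      · exact card_insert_of_notMem fun h => hvW (mem_filter.1 h).1
      · exact absurd h₁.symm h₂
      · exact absurd h₂.symm h₁
      · rfl
    intro i i'
    rw [hcards, hcards]
    have h₁ := hp.equitable i i'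
    have h₂ := hp.div_le_card i'
    rw [hcard] at h₂
    split_ifs with hi hi' hi'
    · omega
    · subst hi
      omega
    · omega
    · omega

theorem card_satColors_erase_add_le (W : Finset V) (v : V) (a : ℕ) :
    #((satColors G col W v).erase a) + #((starIn G W v).filter (col · = a)) ≤
      #(starIn G W v) := by
  have hsub : (satColors G col W v).erase a ⊆
      ((starIn G W v).filter (fun e => ¬ col e = a)).image col := by
    intro b hb
    obtain ⟨hba, hb⟩ := mem_erase.1 hb
    obtain ⟨e, he, rfl⟩ := mem_image.1 (satColors_subset_image_starIn W v hb)
    exact mem_image_of_mem _ (mem_filter.2 ⟨he, hba⟩)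
  have h₁ := (card_le_card hsub).trans card_image_le
  have h₂ := card_filter_add_card_filter_not (s := starIn G W v) (col · = a)
  omega

theorem card_starIn_add_card_satColors_ge {W : Finset V} {r : ℕ} (hr : 0 < r) (hW : #W = 2 * r)
    (hw : weight G col W = rainbowBound (2 * r) r)
    (hno : ¬ ∃ t ⊆ W, #t = r + 2 ∧ IsRainbowClique G col t) {v : V} (hv : v ∈ W) :
    4 * r ≤ #(starIn G W v) + #(satColors G col W v) + 3 := by
  by_contra! hlt
  have hcard : #(W.erase v) = 2 * r - 1 := by rw [card_erase_of_mem hv, hW]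
  have hdeg := weight_erase_add (G := G) (col := col) W v
  have hb := rainbowBound_add_of_le (2 * r) r hr (by omega) le_rfl
  obtain ⟨t, ht, h⟩ := exists_isRainbowClique_of_le_weight_add (G := G) (col := col) (r + 2)
    (W.erase v) (by
      rw [hcard]
      obtain ⟨q, rfl⟩ : ∃ q, r = q + 1 := ⟨r - 1, by omega⟩
      have h₁ : 2 * (q + 1) - 1 = 2 * q + 1 := by omega
      rw [h₁, Nat.add_sub_cancel]
      nlinarith)
  exact hno ⟨t, ht.trans (erase_subset _ _), h⟩

/-- If every vertex is incident to at most one edge that is not saturated, a color with `i ≥ 1`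
saturating vertices appears at most `3 - i` times. -/
theorem card_filter_color_add_card_satVertices_le {W : Finset V} {a : ℕ}
    (hstar : ∀ v ∈ W, #(starIn G W v) ≤ #(satColors G col W v) + 1)
    (ha : a ∈ (edgesIn G W).image col) (hpos : 0 < #(satVertices G col W a)) :
    #((edgesIn G W).filter (col · = a)) + #(satVertices G col W a) ≤ 3 := by
  obtain ⟨v, hv⟩ := card_pos.1 hpos
  obtain ⟨hvW, hva⟩ := mem_filter.1 hv
  have htwo := card_satVertices_le_two ha
  rcases Nat.lt_or_ge #(satVertices G col W a) 2 with hlt | hge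
  · have hsub : (edgesIn G W).filter (col · = a) ⊆ (starIn G W v).filter (col · = a) := by
      intro e he
      obtain ⟨he, hea⟩ := mem_filter.1 he
      exact mem_filter.2 ⟨mem_filter.2 ⟨he, hva e he hea⟩, hea⟩
    have h₁ := card_le_card hsub
    have h₂ := card_satColors_erase_add_le (G := G) (col := col) W v a
    have h₃ := hstar v hvW
    have h₄ := pred_card_le_card_erase (s := satColors G col W v) (a := a)
    omega
  · have h₁ : #((edgesIn G W).filter (col · = a)) ≤ 1 := by
      refine card_le_one.2 fun e he f hf => ?_
      obtain ⟨he', rfl⟩ := mem_filter.1 he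
      obtain ⟨hf', hfe⟩ := mem_filter.1 hf
      exact eq_of_two_le_card_satVertices he' hf' hfe.symm hge
    omega

/-- If all vertices have large degree and saturated degree, all but one of the colors appear
only once. -/
theorem exists_color_forall_eq_of_color_ne {W : Finset V} {r : ℕ} (hr : 4 ≤ r) (hW : #W = 2 * r)
    (hw : weight G col W = rainbowBound (2 * r) r)
    (hstar : ∀ v ∈ W, #(starIn G W v) + 1 = 2 * r)
    (hsat : ∀ v ∈ W, 2 * r ≤ #(satColors G col W v) + 2) :
    ∃ a, #((edgesIn G W).filter (col · = a)) = r ∧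
      (∀ v ∈ W, #(((edgesIn G W).filter (col · = a)).filter (v ∈ ·)) ≤ 1) ∧
      ∀ e ∈ edgesIn G W, ∀ f ∈ edgesIn G W, col e ≠ a → col e = col f → e = f := by
  set C := (edgesIn G W).image col with hC
  have hb := rainbowBound_add_of_le (2 * r) r (by omega) (by omega) le_rfl
  have hm : 2 * #(edgesIn G W) = 2 * r * (2 * r - 1) := by
    rw [← sum_card_filter_mem W Subset.rfl, ← hW]
    refine sum_const_nat fun v hv => ?_
    have := hstar v hv
    unfold starIn at this
    omega
  have hσ : 2 * r * (2 * r - 2) ≤ ∑ a ∈ C, #(satVertices G col W a) := by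
    rw [hC, ← sum_card_satColors, ← hW, ← smul_eq_mul]
    refine card_nsmul_le_sum _ _ _ fun v hv => ?_
    have := hsat v hv
    omega
  have hκ : #(edgesIn G W) = ∑ a ∈ C, #((edgesIn G W).filter (col · = a)) :=
    card_eq_sum_card_image col _
  have hmc : #(edgesIn G W) + #C = rainbowBound (2 * r) r := hw
  have hmr : #(edgesIn G W) + r = 2 * r * r := by
    obtain ⟨q, rfl⟩ : ∃ q, r = q + 1 := ⟨r - 1, by omega⟩
    have h₁ : 2 * (q + 1) - 1 = 2 * q + 1 := by omega
    rw [h₁] at hm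
    linarith
  have hcr : #C + 2 * r = 2 * r * r + 1 := by linarith
  have hσc : 2 * #C ≤ ∑ a ∈ C, #(satVertices G col W a) + 2 := by
    obtain ⟨q, rfl⟩ : ∃ q, r = q + 1 := ⟨r - 1, by omega⟩
    have h₁ : 2 * (q + 1) - 2 = 2 * q := by omega
    rw [h₁] at hσ
    linarith
  obtain ⟨a, ha, hσa⟩ : ∃ a ∈ C, #(satVertices G col W a) = 0 := by
    by_contra! hpos
    have h₁ : ∑ a ∈ C, (#((edgesIn G W).filter (col · = a)) + #(satVertices G col W a)) ≤
        #C * 3 := by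
      refine sum_le_card_nsmul _ _ 3 fun a ha => ?_
      refine card_filter_color_add_card_satVertices_le (fun v hv => ?_) ha
        (Nat.pos_of_ne_zero (hpos a ha))
      have := hstar v hv
      have := hsat v hv
      omega
    rw [sum_add_distrib, ← hκ] at h₁
    omega
  have hσtwo : ∀ b ∈ C, b ≠ a → #(satVertices G col W b) = 2 := by
    have h₁ := add_sum_erase C (fun b => #(satVertices G col W b)) ha
    have h₂ := card_erase_add_one ha
    have hle : ∀ b ∈ C.erase a, #(satVertices G col W b) ≤ 2 := fun b hb =>
      card_satVertices_le_two (mem_of_mem_erase hb)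
    have h₃ : ∑ b ∈ C.erase a, #(satVertices G col W b) = ∑ _b ∈ C.erase a, 2 := by
      refine le_antisymm (sum_le_sum hle) ?_
      rw [sum_const, smul_eq_mul]
      simp only [hσa] at h₁
      omega
    exact fun b hb hba => (sum_eq_sum_iff_of_le hle).1 h₃ b (mem_erase.2 ⟨hba, hb⟩)
  have hunique : ∀ e ∈ edgesIn G W, ∀ f ∈ edgesIn G W, col e ≠ a → col e = col f → e = f :=
    fun e he f hf hea hef => eq_of_two_le_card_satVertices he hf hef
      (hσtwo _ (mem_image_of_mem _ he) hea).ge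
  refine ⟨a, ?_, fun v hv => ?_, hunique⟩
  · have h₁ := add_sum_erase C (fun b => #((edgesIn G W).filter (col · = b))) ha
    have h₂ := card_erase_add_one ha
    have h₃ : ∑ b ∈ C.erase a, #((edgesIn G W).filter (col · = b)) = #(C.erase a) * 1 := by
      refine sum_const_nat fun b hb => ?_
      obtain ⟨hba, hb⟩ := mem_erase.1 hb
      obtain ⟨e, he, rfl⟩ := mem_image.1 hb
      refine card_eq_one.2 ⟨e, eq_singleton_iff_unique_mem.2 ⟨mem_filter.2 ⟨he, rfl⟩, ?_⟩⟩
      intro f hf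
      obtain ⟨hf, hfe⟩ := mem_filter.1 hf
      exact (hunique e he f hf hba hfe.symm).symm
    rw [← hκ] at h₁
    omega
  · have h₁ := card_satColors_erase_add_le (G := G) (col := col) W v a
    have h₂ : a ∉ satColors G col W v := by
      intro hav
      have hmem : v ∈ satVertices G col W a := mem_filter.2 ⟨hv, (mem_satColors.1 hav).2⟩
      rw [card_eq_zero.1 hσa] at hmem
      exact notMem_empty v hmem
    rw [erase_eq_of_notMem h₂] at h₁
    have h₃ := hstar v hv
    have h₄ := hsat v hv
    rw [filter_comm]
    unfold starIn at h₁ h₃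
    omega

theorem exists_isTuranColored_of_card_eq {W : Finset V} {r : ℕ} (hr : 4 ≤ r) (hW : #W = 2 * r)
    (hw : weight G col W = rainbowBound (2 * r) r)
    (hno : ¬ ∃ t ⊆ W, #t = r + 2 ∧ IsRainbowClique G col t) :
    ∃ p : V → Fin r, IsTuranColored G col W p := by
  have hstar : ∀ v ∈ W, #(starIn G W v) + 1 = 2 * r := by
    intro v hv
    have h₁ := card_starIn_add_card_satColors_ge (by omega) hW hw hno hv
    have h₂ := card_satColors_le (G := G) (col := col) W v
    have h₃ := card_starIn_le (G := G) W hv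
    omega
  have hsat : ∀ v ∈ W, 2 * r ≤ #(satColors G col W v) + 2 := by
    intro v hv
    have h₁ := card_starIn_add_card_satColors_ge (by omega) hW hw hno hv
    have h₂ := hstar v hv
    omega
  have hadj : ∀ u ∈ W, ∀ w ∈ W, u ≠ w → G.Adj u w := by
    intro u hu w hw huw
    by_contra h
    have h₁ := card_starIn_le_of_not_adj hu hw huw.symm h
    have h₂ := hstar u hu
    omega
  obtain ⟨a, hF, hle, hunique⟩ := exists_color_forall_eq_of_color_ne hr hW hw hstar hsat
  set F := (edgesIn G W).filter (col · = a) with hF_def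
  have hFsub : F ⊆ edgesIn G W := filter_subset _ _
  have hone : ∀ v ∈ W, #(F.filter (v ∈ ·)) = 1 := by
    refine (sum_eq_sum_iff_of_le hle).1 ?_
    rw [sum_card_filter_mem W hFsub, hF, sum_const, hW, smul_eq_mul, mul_one]
  have hex : ∀ v, ∃ i : Fin r, v ∈ W → v ∈ ((F.equivFinOfCardEq hF).symm i).1 := by
    intro v
    by_cases hv : v ∈ W
    · obtain ⟨e, he⟩ := card_eq_one.1 (hone v hv)
      obtain ⟨heF, hve⟩ := mem_filter.1 (he ▸ mem_singleton_self e : e ∈ F.filter (v ∈ ·))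
      exact ⟨F.equivFinOfCardEq hF ⟨e, heF⟩, fun _ => by simpa using hve⟩
    · exact ⟨⟨0, by omega⟩, fun h => absurd h hv⟩
  choose p hp using hex
  have hpmem : ∀ v ∈ W, ∀ e (he : e ∈ F), v ∈ e → F.equivFinOfCardEq hF ⟨e, he⟩ = p v := by
    intro v hv e he hve
    rw [← Equiv.eq_symm_apply]
    exact Subtype.ext (card_le_one.1 (hle v hv) e (mem_filter.2 ⟨he, hve⟩) _
      (mem_filter.2 ⟨Subtype.prop _, hp v hv⟩))
  refine ⟨p, hadj, fun u hu w hw x hx y hy hpuw hxy heq => ?_, fun i j => ?_⟩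
  · have huw : u ≠ w := fun h => hpuw (congrArg p h)
    have he := mk_mem_edgesIn.2 ⟨⟨hu, hw⟩, hadj u hu w hw huw⟩
    refine hunique _ he _ (mk_mem_edgesIn.2 ⟨⟨hx, hy⟩, hadj x hx y hy hxy⟩) (fun hea => ?_) heq
    have heF : s(u, w) ∈ F := mem_filter.2 ⟨he, hea⟩
    exact hpuw ((hpmem u hu _ heF (Sym2.mem_mk_left u w)).symm.trans
      (hpmem w hw _ heF (Sym2.mem_mk_right u w)))
  · have htwo : ∀ i, #(W.filter (p · = i)) = 2 := by
      intro i
      have he := ((F.equivFinOfCardEq hF).symm i).2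
      rw [← card_filter_mem_eq_two (hFsub he)]
      congr 1
      refine filter_congr fun v hv => ⟨?_, fun hve => ?_⟩
      · rintro rfl
        exact hp v hv
      · rw [← hpmem v hv _ he hve]
        simp
    rw [htwo, htwo]
    omega

/-- The extremal colorings for the largest `m + c` without a rainbow clique on `r + 2`
vertices. -/
theorem exists_isTuranColored {r n : ℕ} (hr : 4 ≤ r) (hn : 2 * r ≤ n) {W : Finset V}
    (hW : #W = n) (hw : weight G col W = rainbowBound n r)
    (hno : ¬ ∃ t ⊆ W, #t = r + 2 ∧ IsRainbowClique G col t) :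
    ∃ p : V → Fin r, IsTuranColored G col W p := by
  induction n, hn using Nat.le_induction generalizing W col with
  | base => exact exists_isTuranColored_of_card_eq hr hW hw hno
  | succ n hn ih =>
    refine exists_isTuranColored_of_erase (by omega) hn hW (fun v hv col' hw' hno' => ?_) hw hno
    exact ih (by rw [card_erase_of_mem hv, hW, Nat.add_sub_cancel]) hw' hno'

theorem adj_of_weight_eq_of_le {W : Finset V} {r : ℕ} (hr : 0 < r) (hrW : r + 2 ≤ #W)
    (hW : #W ≤ 2 * r) (hw : weight G col W = rainbowBound #W r)
    (hno : ¬ ∃ t ⊆ W, #t = r + 2 ∧ IsRainbowClique G col t) {u v : V} (hu : u ∈ W) (hv : v ∈ W)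
    (huv : u ≠ v) : G.Adj u v := by
  by_contra hadj
  have hstar := card_starIn_le_of_not_adj hu hv huv.symm hadj
  have hsat := card_satColors_le (G := G) (col := col) W u
  have hdeg := weight_erase_add (G := G) (col := col) W u
  have hb := rainbowBound_add_of_le #W r hr (by omega) hW
  have hcard := card_erase_add_one hu
  obtain ⟨t, ht, h⟩ := exists_isRainbowClique_of_le_weight_add (G := G) (col := col) (r + 2)
    (W.erase u) (by
      obtain ⟨q, hq⟩ : ∃ q, #W = q + 2 := ⟨#W - 2, by omega⟩
      have hq' : #(W.erase u) = q + 1 := by omega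
      rw [hq', Nat.add_sub_cancel]
      rw [hq] at hb hw hstar
      nlinarith)
  exact hno ⟨t, ht.trans (erase_subset _ _), h⟩

end Weight

/-- If `G` is an edge-colored graph on `n ≥ k ≥ 6` vertices with
`m(G) + c(G) = (n choose 2) + t_{n,k-2} + 1` and no rainbow `K_k`, then `G` is
complete. -/
theorem stmt_11 (n k : ℕ) (hk : 6 ≤ k) (hkn : k ≤ n) (G : SimpleGraph (Fin n))
    (col : Sym2 (Fin n) → ℕ)
    (h : G.edgeSet.ncard + (col '' G.edgeSet).ncard =
      n.choose 2 + turanEdges n (k - 2) + 1)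
    (hno : ¬ ∃ s : Finset (Fin n), s.card = k ∧ IsRainbowClique G col s) :
    G = ⊤ := by
  classical
  obtain ⟨r, rfl⟩ : ∃ r, k = r + 2 := ⟨k - 2, by omega⟩
  rw [Nat.add_sub_cancel] at h
  have hedges : G.edgeSet = ↑(edgesIn G univ) := by
    ext e
    simp [mem_edgesIn]
  have hw : weight G col univ = rainbowBound #(univ : Finset (Fin n)) r := by
    rw [hedges, ← coe_image, Set.ncard_coe_finset, Set.ncard_coe_finset] at h
    rw [card_univ, Fintype.card_fin]
    exact h
  have hno' : ¬ ∃ t ⊆ (univ : Finset (Fin n)), #t = r + 2 ∧ IsRainbowClique G col t :=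
    fun ⟨t, _, ht⟩ => hno ⟨t, ht⟩
  have hcard : #(univ : Finset (Fin n)) = n := by rw [card_univ, Fintype.card_fin]
  have hadj : ∀ u w, u ≠ w → G.Adj u w := by
    intro u w huw
    rcases Nat.le_total n (2 * r) with hn | hn
    · exact adj_of_weight_eq_of_le (by omega) (by omega) (by omega) hw hno' (mem_univ u)
        (mem_univ w) huw
    · obtain ⟨p, hp⟩ := exists_isTuranColored (by omega) (hcard.symm ▸ hn) rfl hw hno'
      exact hp.adj u (mem_univ u) w (mem_univ w) huw
  ext u w
  exact ⟨fun huw => huw.ne, hadj u w⟩
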